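/- Let x and y be two nonzero vectors in ℝ^m that are not scalar multiples of one another, let u = x/‖x‖₂, assume ‖x‖₂ > ‖y‖₂, let β > 1, and set Δ = β(uᵀx)² − (uᵀy)². Then for every real α, the equation ‖(I − α u uᵀ) y‖₂² = β ‖(I − α u uᵀ) x‖₂² holds if and only if Δ α² − 2Δ α + (β‖x‖₂² − ‖y‖₂²) = 0. -/

import Mathlib

open RealInnerProductSpace

/-- Squared norm of `z` after subtracting `α` times its projection onto a unit vector `u`. -/
theorem norm_sub_smul_inner_smul_sq {E : Type*} [NormedAddCommGroup E] [InnerProductSpace ℝ E]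
    {u : E} (hu : ‖u‖ = 1) (z : E) (α : ℝ) :
    ‖z - α • ⟪u, z⟫ • u‖ ^ 2 = ‖z‖ ^ 2 + (α ^ 2 - 2 * α) * ⟪u, z⟫ ^ 2 := by
  rw [norm_sub_sq_real, smul_smul, norm_smul, hu, inner_smul_right, real_inner_comm,
    mul_one, Real.norm_eq_abs, sq_abs]
  ring

/-- Under the hypotheses of Lemma 1, with `Δ = β(uᵀx)² − (uᵀy)²`, for every real `α` the
equation `‖(I − α u uᵀ) y‖₂² = β ‖(I − α u uᵀ) x‖₂²` holds if and only if
`Δ α² − 2Δ α + (β‖x‖₂² − ‖y‖₂²) = 0`. -/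
theorem rspa_equation_iff_quadratic {m : ℕ} (x y u : EuclideanSpace ℝ (Fin m))
    (hx : x ≠ 0) (hy : y ≠ 0)
    (hnm : ∀ t : ℝ, x ≠ t • y ∧ y ≠ t • x)
    (hu : u = ‖x‖⁻¹ • x)
    (hxy : ‖y‖ < ‖x‖)
    (β : ℝ) (hβ : 1 < β)
    (Δ : ℝ) (hΔ : Δ = β * ⟪u, x⟫ ^ 2 - ⟪u, y⟫ ^ 2) :
    ∀ α : ℝ,
      ‖y - α • ⟪u, y⟫ • u‖ ^ 2 = β * ‖x - α • ⟪u, x⟫ • u‖ ^ 2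
      ↔ Δ * α ^ 2 - 2 * Δ * α + (β * ‖x‖ ^ 2 - ‖y‖ ^ 2) = 0 := by
  intro α
  have hu1 : ‖u‖ = 1 := by
    rw [hu, norm_smul, norm_inv, norm_norm, inv_mul_cancel₀ (norm_ne_zero_iff.mpr hx)]
  rw [norm_sub_smul_inner_smul_sq hu1, norm_sub_smul_inner_smul_sq hu1, hΔ]
  constructor <;> intro h <;> linear_combination -h
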